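/- Let q be a prime power, F the finite field with q elements, n ≥ 2 an integer, and δ ∈ [0,(q-1)/q). The rate R of every all-disjoint linearly recoverable (δ,n)-LRC sequence over F satisfies R ≤ R_2(δ,n) := min over ω ∈ [δ/2,(q-1)/q] of the quantity R_0(ω,n) + R_opt(δ,ω). -/

import Mathlib

open Filter Set

noncomputable section

/-- Minimum (Hamming) distance of a code. -/
def minDist {K : Type} [DecidableEq K] {ι : Type} [Fintype ι] (C : Set (ι → K)) : ℕ :=
  sInf {d : ℕ | ∃ c ∈ C, ∃ c' ∈ C, c ≠ c' ∧ hammingDist c c' = d}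

/-- `Rg` exhibits `C` as a linearly recoverable LRC with locality `n - 1`. -/
def IsLinRecLRC {K : Type} [Field K] {N : ℕ} (C : Set (Fin N → K)) (n : ℕ)
    (Rg : Fin N → Finset (Fin N)) : Prop :=
  ∀ j : Fin N, j ∈ Rg j ∧ (Rg j).card ≤ n ∧
    ∃ a : Fin N → K, (∀ i, i ∉ (Rg j).erase j → a i = 0) ∧
      ∀ c ∈ C, c j = ∑ i, a i * c i

/-- The distinct members of the list of repair groups `Rg` form a partition of the
coordinate set. -/
def IsAllDisjoint {N : ℕ} (Rg : Fin N → Finset (Fin N)) : Prop :=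
  ∀ j j' : Fin N, Rg j = Rg j' ∨ Disjoint (Rg j) (Rg j')

/-- `λ_q(ω,n)`. -/
def lambdaQ (q : ℕ) (ω : ℝ) (n : ℕ) : ℝ :=
  ⨅ z : Set.Ioc (0:ℝ) 1,
    (-ω * Real.logb q (z : ℝ) - 1 / n +
      (1 / n) * Real.logb q ((1 + ((q:ℝ) - 1) * (z:ℝ)) ^ n + ((q:ℝ) - 1) * (1 - (z:ℝ)) ^ n))

/-- `R_0(ω,n) = (n-1)/n - λ_q(ω,n)`. -/
def R0 (q : ℕ) (ω : ℝ) (n : ℕ) : ℝ := ((n:ℝ) - 1) / n - lambdaQ q ω n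

/-- `R_opt(δ,ω)`: the supremum of rates of infinite sequences of constant-weight codes
over `K` with relative minimum distance at least `δ` and relative codeword weight
tending to `ω`. -/
def RoptCW (K : Type) [Field K] [Fintype K] [DecidableEq K] (q : ℕ) (δ ω : ℝ) : ℝ :=
  sSup {R : ℝ | ∃ (N : ℕ → ℕ) (C : ∀ i : ℕ, Set (Fin (N i) → K)) (w : ℕ → ℕ),
    StrictMono N ∧ (∀ i, (C i).Nonempty) ∧
    (∀ i, ∀ c ∈ C i, hammingNorm c = w i) ∧
    Tendsto (fun i => (w i : ℝ) / (N i : ℝ)) atTop (nhds ω) ∧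
    δ ≤ liminf (fun i => (minDist (C i) : ℝ) / (N i : ℝ)) atTop ∧
    R = limsup (fun i => Real.logb q ((C i).ncard : ℝ) / (N i : ℝ)) atTop}


section Enumerators

open Polynomial

variable {K : Type} [Field K] [DecidableEq K]

/-- The weight enumerator of a single unconstrained coordinate. -/
lemma sum_ite_zero_one [Fintype K] {R : Type*} [CommRing R] (z : R) :
    ∑ k : K, (if k = 0 then 1 else z) = 1 + ((Fintype.card K : R) - 1) * z := by
  have h : ∀ k : K, (if k = 0 then (1 : R) else z) = z + (if k = 0 then 1 - z else 0) := by
    intro k; split_ifs <;> ring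
  simp only [h, Finset.sum_add_distrib, Finset.sum_ite_eq', Finset.mem_univ, if_true,
    Finset.sum_const, Finset.card_univ, nsmul_eq_mul]
  ring

/-- The weight enumerator of the solutions of one linear equation, over `Fin m`. -/
lemma card_mul_sum_fin [Fintype K] {R : Type*} [CommRing R] (z : R) (m : ℕ) :
    ∀ (h : Fin m → K) (y : K),
    (Fintype.card K : R) * ∑ x : Fin m → K,
      (if ∑ i, h i * x i = y then ∏ i, (if x i = 0 then 1 else z) else 0) =
    (1 + ((Fintype.card K : R) - 1) * z) ^ m +
      ((if y = 0 then (Fintype.card K : R) else 0) - 1) *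
        ∏ i, (if h i = 0 then 1 + ((Fintype.card K : R) - 1) * z else 1 - z) := by
  induction m with
  | zero =>
    intro h y
    by_cases hy : y = 0
    · simp [hy]
    · simp [hy, Ne.symm hy]
  | succ m ih =>
    intro h y
    set a : R := 1 + ((Fintype.card K : R) - 1) * z with ha
    have split : ∑ x : Fin (m + 1) → K,
        (if ∑ i, h i * x i = y then ∏ i, (if x i = 0 then 1 else z) else 0) =
        ∑ k : K, (if k = 0 then 1 else z) * ∑ x : Fin m → K,
          (if ∑ i, h i.succ * x i = y - h 0 * k then
            ∏ i, (if x i = 0 then (1 : R) else z) else 0) := by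
      simp only [Finset.mul_sum]
      rw [← Fintype.sum_prod_type']
      refine (Fintype.sum_equiv (Fin.consEquiv (fun _ => K)) _ _ ?_).symm
      rintro ⟨k, x⟩
      simp only [Fin.consEquiv, Equiv.coe_fn_mk, Fin.sum_univ_succ, Fin.prod_univ_succ,
        Fin.cons_zero, Fin.cons_succ, mul_ite, mul_zero, eq_sub_iff_add_eq']
    rw [split, Finset.mul_sum]
    have step : ∀ k : K, (Fintype.card K : R) * ((if k = 0 then 1 else z) *
        ∑ x : Fin m → K, (if ∑ i, h i.succ * x i = y - h 0 * k then
            ∏ i, (if x i = 0 then (1 : R) else z) else 0)) =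
        (if k = 0 then 1 else z) * (a ^ m - ∏ i : Fin m, (if h i.succ = 0 then a else 1 - z)) +
        (if k = 0 then 1 else z) * (if y - h 0 * k = 0 then (Fintype.card K : R) else 0) *
          ∏ i : Fin m, (if h i.succ = 0 then a else 1 - z) := by
      intro k
      rw [mul_left_comm, ih (fun i => h i.succ) (y - h 0 * k)]
      ring
    simp only [step, Finset.sum_add_distrib, ← Finset.sum_mul, sum_ite_zero_one]
    rw [← ha, Fin.prod_univ_succ]
    set T := ∏ i : Fin m, (if h i.succ = 0 then a else 1 - z)
    by_cases h0 : h 0 = 0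
    · simp only [h0, zero_mul, sub_zero, if_true, ← Finset.sum_mul, sum_ite_zero_one, ← ha]
      ring
    · have hk : ∀ k : K, (y - h 0 * k = 0) ↔ k = y / h 0 := by
        intro k
        rw [sub_eq_zero, eq_div_iff h0, mul_comm, eq_comm]
      simp only [hk, mul_ite, mul_zero, Finset.sum_ite_eq', Finset.mem_univ, if_true, h0,
        if_false, div_eq_zero_iff, or_false]
      split_ifs
      · rw [ha]; ring
      · rw [ha]; ring

/-- The weight enumerator of a finite code. -/
def wtEnum {ι : Type*} [Fintype ι] (V : Finset (ι → K)) : ℝ[X] :=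
  ∑ v ∈ V, X ^ hammingNorm v

/-- The code defined by a single parity check. -/
def parityCode [Fintype K] {ι : Type*} [Fintype ι] [DecidableEq ι] (h : ι → K) : Finset (ι → K) :=
  Finset.univ.filter fun x => ∑ i, h i * x i = 0

lemma pow_hammingNorm {ι R : Type*} [Fintype ι] [CommRing R] (z : R) (x : ι → K) :
    z ^ hammingNorm x = ∏ i, (if x i = 0 then 1 else z) := by
  rw [Finset.prod_ite]
  simp [hammingNorm]

lemma card_mul_wtEnum_parityCode [Fintype K] {ι : Type*} [Fintype ι] [DecidableEq ι] (h : ι → K) :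
    (Fintype.card K : ℝ[X]) * wtEnum (parityCode h) =
    (1 + ((Fintype.card K : ℝ[X]) - 1) * X) ^ Fintype.card ι +
      ((Fintype.card K : ℝ[X]) - 1) *
        ((1 + ((Fintype.card K : ℝ[X]) - 1) * X) ^ (Finset.univ.filter fun i => h i = 0).card *
        (1 - X) ^ (Finset.univ.filter fun i => h i ≠ 0).card) := by
  classical
  have key := card_mul_sum_fin (X : ℝ[X]) (Fintype.card ι)
    (fun i => h ((Fintype.equivFin ι).symm i)) 0
  rw [if_pos rfl] at key
  rw [Equiv.prod_comp (Fintype.equivFin ι).symm (fun i => if h i = 0 then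
    1 + ((Fintype.card K : ℝ[X]) - 1) * X else 1 - X), Finset.prod_ite, Finset.prod_const,
    Finset.prod_const] at key
  rw [← key, wtEnum, parityCode, Finset.sum_filter]
  congr 1
  refine Fintype.sum_equiv (Equiv.arrowCongr (Fintype.equivFin ι) (Equiv.refl K)) _ _ ?_
  intro x
  simp only [pow_hammingNorm]
  rw [← Equiv.sum_comp (Fintype.equivFin ι).symm (fun i => h i * x i),
    ← Equiv.prod_comp (Fintype.equivFin ι).symm (fun i => if x i = 0 then (1 : ℝ[X]) else X)]
  rfl

/-- The code cut out by one parity check in every block of a labelling `l`. -/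
def blockCode [Fintype K] {ι κ : Type*} [Fintype ι] [Fintype κ] [DecidableEq κ] [DecidableEq ι]
    (l : ι → κ) (h : ι → K) :
    Finset (ι → K) :=
  Finset.univ.filter fun x => ∀ b, ∑ i : {i // l i = b}, h i * x i = 0

/-- Splitting a word into its blocks. -/
def blockEquiv {ι κ : Type*} (l : ι → κ) (K : Type) :
    (ι → K) ≃ ((b : κ) → {i // l i = b} → K) where
  toFun v b i := v i
  invFun y i := y (l i) ⟨i, rfl⟩
  left_inv v := rfl
  right_inv y := by
    funext b ⟨i, hi⟩
    subst hi
    rfl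

lemma wtEnum_blockCode [Fintype K] {ι κ : Type*} [Fintype ι] [Fintype κ] [DecidableEq κ] [DecidableEq ι]
    (l : ι → κ) (h : ι → K) :
    wtEnum (blockCode l h) = ∏ b, wtEnum (parityCode fun i : {i // l i = b} => h i) := by
  classical
  simp only [wtEnum, parityCode, Finset.sum_filter, blockCode]
  rw [Finset.prod_univ_sum, Fintype.piFinset_univ]
  refine Fintype.sum_equiv (blockEquiv l K) _ _ ?_
  intro x
  simp only [pow_hammingNorm, blockEquiv, Equiv.coe_fn_mk]
  rw [Finset.prod_ite_zero]
  simp only [Finset.mem_univ, forall_const]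
  split_ifs with hx
  · exact (Fintype.prod_fiberwise l _).symm
  · rfl

end Enumerators

section Moments

open Polynomial

/-- The Euler operator `X d/dX`. -/
def eulerOp (p : ℝ[X]) : ℝ[X] := X * derivative p

/-- The mean of the exponent under the coefficients of `p` tilted by `z`. -/
def tiltMean (p : ℝ[X]) (z : ℝ) : ℝ := (eulerOp p).eval z / p.eval z

/-- The variance of the exponent under the coefficients of `p` tilted by `z`. -/
def tiltVar (p : ℝ[X]) (z : ℝ) : ℝ :=
  (eulerOp (eulerOp p)).eval z / p.eval z - tiltMean p z ^ 2

lemma tiltMean_mul {p r : ℝ[X]} {z : ℝ} (hp : p.eval z ≠ 0) (hr : r.eval z ≠ 0) :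
    tiltMean (p * r) z = tiltMean p z + tiltMean r z := by
  simp only [tiltMean, eulerOp, derivative_mul, eval_mul, eval_add, eval_X]
  field_simp

lemma tiltVar_mul {p r : ℝ[X]} {z : ℝ} (hp : p.eval z ≠ 0) (hr : r.eval z ≠ 0) :
    tiltVar (p * r) z = tiltVar p z + tiltVar r z := by
  simp only [tiltVar, tiltMean_mul hp hr]
  simp only [tiltMean, eulerOp, derivative_mul, derivative_add, derivative_X, eval_mul, eval_add,
    eval_X, eval_one]
  field_simp
  ring

lemma tiltMean_prod {κ : Type*} (s : Finset κ) (p : κ → ℝ[X]) {z : ℝ}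
    (hp : ∀ b, (p b).eval z ≠ 0) :
    tiltMean (∏ b ∈ s, p b) z = ∑ b ∈ s, tiltMean (p b) z := by
  classical
  induction s using Finset.induction_on with
  | empty => simp [tiltMean, eulerOp]
  | insert a s ha ih =>
    rw [Finset.prod_insert ha, Finset.sum_insert ha, tiltMean_mul (hp a), ih]
    rw [eval_prod]
    exact Finset.prod_ne_zero_iff.2 fun b _ => hp b

lemma tiltVar_prod {κ : Type*} (s : Finset κ) (p : κ → ℝ[X]) {z : ℝ}
    (hp : ∀ b, (p b).eval z ≠ 0) :
    tiltVar (∏ b ∈ s, p b) z = ∑ b ∈ s, tiltVar (p b) z := by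
  classical
  induction s using Finset.induction_on with
  | empty => simp [tiltVar, tiltMean, eulerOp]
  | insert a s ha ih =>
    rw [Finset.prod_insert ha, Finset.sum_insert ha, tiltVar_mul (hp a), ih]
    rw [eval_prod]
    exact Finset.prod_ne_zero_iff.2 fun b _ => hp b

lemma eulerOp_X_pow (k : ℕ) : eulerOp (X ^ k) = C (k : ℝ) * X ^ k := by
  cases k with
  | zero => simp [eulerOp]
  | succ k => simp [eulerOp]; ring

lemma eulerOp_C_mul (a : ℝ) (p : ℝ[X]) : eulerOp (C a * p) = C a * eulerOp p := by
  simp [eulerOp]; ring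

lemma eulerOp_sum {κ : Type*} (s : Finset κ) (p : κ → ℝ[X]) :
    eulerOp (∑ b ∈ s, p b) = ∑ b ∈ s, eulerOp (p b) := by
  simp [eulerOp, Finset.mul_sum]

variable {K : Type} [Field K] [DecidableEq K] {ι : Type*} [Fintype ι]

lemma eval_wtEnum (V : Finset (ι → K)) (z : ℝ) :
    (wtEnum V).eval z = ∑ v ∈ V, z ^ hammingNorm v := by
  simp [wtEnum, eval_finsetSum]

lemma eval_one_wtEnum (V : Finset (ι → K)) : (wtEnum V).eval 1 = V.card := by
  simp [eval_wtEnum]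

lemma eval_eulerOp_wtEnum (V : Finset (ι → K)) (z : ℝ) :
    (eulerOp (wtEnum V)).eval z = ∑ v ∈ V, (hammingNorm v : ℝ) * z ^ hammingNorm v := by
  simp [wtEnum, eulerOp_sum, eulerOp_X_pow, eval_finsetSum]

lemma eval_eulerOp_eulerOp_wtEnum (V : Finset (ι → K)) (z : ℝ) :
    (eulerOp (eulerOp (wtEnum V))).eval z =
      ∑ v ∈ V, (hammingNorm v : ℝ) ^ 2 * z ^ hammingNorm v := by
  rw [wtEnum, eulerOp_sum]
  simp only [eulerOp_X_pow]
  rw [eulerOp_sum]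
  simp only [eulerOp_C_mul, eulerOp_X_pow, eval_finsetSum]
  refine Finset.sum_congr rfl fun v _ => ?_
  simp; ring

lemma one_le_eval_wtEnum {V : Finset (ι → K)} (h0 : 0 ∈ V) {z : ℝ} (hz : 0 ≤ z) :
    1 ≤ (wtEnum V).eval z := by
  rw [eval_wtEnum]
  refine le_trans (by simp) (Finset.single_le_sum (f := fun v => z ^ hammingNorm v)
    (fun v _ => by positivity) h0)

lemma tiltVar_wtEnum_le {V : Finset (ι → K)} (h0 : 0 ∈ V) {z : ℝ} (hz : 0 ≤ z) :
    tiltVar (wtEnum V) z ≤ (Fintype.card ι : ℝ) ^ 2 := by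
  have hpos := one_le_eval_wtEnum h0 hz
  have : (eulerOp (eulerOp (wtEnum V))).eval z / (wtEnum V).eval z ≤ (Fintype.card ι : ℝ) ^ 2 := by
    rw [div_le_iff₀ (by linarith), eval_eulerOp_eulerOp_wtEnum, eval_wtEnum, Finset.mul_sum]
    gcongr with v _
    exact hammingNorm_le_card_fintype
  unfold tiltVar
  nlinarith [sq_nonneg (tiltMean (wtEnum V) z)]

lemma tiltMean_wtEnum_nonneg (V : Finset (ι → K)) {z : ℝ} (hz : 0 ≤ z) :
    0 ≤ tiltMean (wtEnum V) z := by
  rw [tiltMean, eval_eulerOp_wtEnum, eval_wtEnum]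
  positivity

lemma tiltMean_wtEnum_le {V : Finset (ι → K)} (h0 : 0 ∈ V) {z : ℝ} (hz : 0 ≤ z) (hz1 : z ≤ 1) :
    tiltMean (wtEnum V) z ≤ z * (Fintype.card ι * V.card) := by
  have hpos := one_le_eval_wtEnum h0 hz
  rw [tiltMean]
  refine (div_le_self ?_ hpos).trans ?_
  · rw [eval_eulerOp_wtEnum]; positivity
  rw [eval_eulerOp_wtEnum]
  have : ∀ v ∈ V, (hammingNorm v : ℝ) * z ^ hammingNorm v ≤ z * Fintype.card ι := by
    intro v _
    rcases Nat.eq_zero_or_pos (hammingNorm v) with h | h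
    · rw [h]; simp; positivity
    · rw [mul_comm z]
      gcongr
      · exact hammingNorm_le_card_fintype
      · exact pow_le_of_le_one hz hz1 h.ne'
  refine (Finset.sum_le_card_nsmul _ _ _ this).trans (le_of_eq ?_)
  rw [nsmul_eq_mul]; ring

/-- The tilted variance as a centred second moment. -/
lemma sum_sq_sub_tiltMean {V : Finset (ι → K)} (h0 : 0 ∈ V) {z : ℝ} (hz : 0 ≤ z) :
    ∑ v ∈ V, ((hammingNorm v : ℝ) - tiltMean (wtEnum V) z) ^ 2 * z ^ hammingNorm v =
      tiltVar (wtEnum V) z * (wtEnum V).eval z := by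
  have hpos := one_le_eval_wtEnum h0 hz
  set μ := tiltMean (wtEnum V) z with hμ
  have e1 : (eulerOp (wtEnum V)).eval z = μ * (wtEnum V).eval z := by
    rw [hμ, tiltMean]; field_simp
  have e2 : tiltVar (wtEnum V) z * (wtEnum V).eval z =
      (eulerOp (eulerOp (wtEnum V))).eval z - μ ^ 2 * (wtEnum V).eval z := by
    rw [tiltVar, ← hμ]; field_simp
  have e3 : ∀ v : ι → K, ((hammingNorm v : ℝ) - μ) ^ 2 * z ^ hammingNorm v =
      (hammingNorm v : ℝ) ^ 2 * z ^ hammingNorm v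
        - 2 * μ * ((hammingNorm v : ℝ) * z ^ hammingNorm v) + μ ^ 2 * z ^ hammingNorm v := by
    intro v; ring
  simp only [e3, Finset.sum_add_distrib, Finset.sum_sub_distrib, ← Finset.mul_sum]
  rw [← eval_wtEnum, ← eval_eulerOp_wtEnum, ← eval_eulerOp_eulerOp_wtEnum, e2, e1]
  ring

/-- Some weight close to the tilted mean carries a large share of the weight enumerator. -/
lemma exists_weight_near_tiltMean {V : Finset (ι → K)} (h0 : 0 ∈ V) {z r : ℝ} (hz : 0 ≤ z)
    (hr : 0 < r) (hvar : 2 * tiltVar (wtEnum V) z ≤ r ^ 2) :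
    ∃ w : ℕ, |(w : ℝ) - tiltMean (wtEnum V) z| ≤ r ∧
      (wtEnum V).eval z ≤ 2 * (Fintype.card ι + 1) *
        ((V.filter fun v => hammingNorm v = w).card * z ^ w) := by
  classical
  have hpos := one_le_eval_wtEnum h0 hz
  set μ := tiltMean (wtEnum V) z with hμ
  set P := (wtEnum V).eval z with hP
  set A := V.filter fun v => |(hammingNorm v : ℝ) - μ| ≤ r with hA
  have far : ∑ v ∈ V.filter (fun v => ¬ |(hammingNorm v : ℝ) - μ| ≤ r), z ^ hammingNorm v
      ≤ P / 2 := by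
    have h1 : r ^ 2 * ∑ v ∈ V.filter (fun v => ¬ |(hammingNorm v : ℝ) - μ| ≤ r),
        z ^ hammingNorm v ≤ tiltVar (wtEnum V) z * P := by
      rw [hP, ← sum_sq_sub_tiltMean h0 hz, Finset.mul_sum]
      refine (Finset.sum_le_sum fun v hv => ?_).trans
        (Finset.sum_le_sum_of_subset_of_nonneg (Finset.filter_subset _ _) fun v _ _ => ?_)
      · have := (Finset.mem_filter.1 hv).2
        rw [not_le] at this
        refine mul_le_mul_of_nonneg_right ?_ (by positivity)
        rw [← sq_abs ((hammingNorm v : ℝ) - _)]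
        exact pow_le_pow_left₀ hr.le this.le 2
      · positivity
    have h2 : r ^ 2 * ∑ v ∈ V.filter (fun v => ¬ |(hammingNorm v : ℝ) - μ| ≤ r),
        z ^ hammingNorm v ≤ r ^ 2 * (P / 2) := by nlinarith
    exact le_of_mul_le_mul_left h2 (by positivity)
  have near : P / 2 ≤ ∑ v ∈ A, z ^ hammingNorm v := by
    have := Finset.sum_filter_add_sum_filter_not V (fun v => |(hammingNorm v : ℝ) - μ| ≤ r)
      (fun v => z ^ hammingNorm v)
    rw [← eval_wtEnum V, ← hP] at this
    linarith
  have maps : ∀ v ∈ A, hammingNorm v ∈ Finset.range (Fintype.card ι + 1) := fun v _ =>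
    Finset.mem_range.2 (Nat.lt_succ_of_le hammingNorm_le_card_fintype)
  rw [← Finset.sum_fiberwise_of_maps_to maps] at near
  obtain ⟨w, hw, hle⟩ : ∃ w ∈ Finset.range (Fintype.card ι + 1),
      P / 2 / (Fintype.card ι + 1) ≤ ∑ v ∈ A with hammingNorm v = w, z ^ hammingNorm v := by
    refine Finset.exists_le_of_sum_le (by simp) ?_
    refine le_trans (le_of_eq ?_) near
    rw [Finset.sum_const, Finset.card_range, nsmul_eq_mul]
    push_cast
    field_simp
  have hne : (A.filter fun v => hammingNorm v = w).Nonempty := by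
    rw [Finset.nonempty_iff_ne_empty]
    intro he
    rw [he, Finset.sum_empty] at hle
    have : 0 < P / 2 / ((Fintype.card ι : ℝ) + 1) := by positivity
    linarith
  obtain ⟨v, hv⟩ := hne
  rw [Finset.mem_filter, hA, Finset.mem_filter] at hv
  refine ⟨w, hv.2 ▸ hv.1.2, ?_⟩
  have hle2 : ∑ v ∈ A with hammingNorm v = w, z ^ hammingNorm v ≤
      (V.filter fun v => hammingNorm v = w).card * z ^ w := by
    rw [Finset.sum_congr rfl (g := fun _ => z ^ w)
      (fun v hv => by rw [(Finset.mem_filter.1 hv).2]), Finset.sum_const, nsmul_eq_mul]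
    gcongr
    exact Finset.filter_subset _ _
  have := hle.trans hle2
  rw [div_div, div_le_iff₀ (by positivity)] at this
  linarith

end Moments

section Blocks

open Polynomial

/-- Comparison of a short block with a block of full length and full support. -/
lemma block_log_le {q a b : ℝ} (hq : 1 < q) (ha : 1 ≤ a) (hb : 0 ≤ b) (hba : b ≤ a)
    {n m s t : ℕ} (hm : t + s = m) (hmn : m ≤ n) (hn : 0 < n) :
    (m : ℝ) * ((1 / n) * Real.logb q (a ^ n + (q - 1) * b ^ n)) ≤
      Real.logb q (a ^ m + (q - 1) * (a ^ t * b ^ s)) := by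
  have ha0 : 0 < a := by linarith
  set x := b / a with hx
  have hx0 : 0 ≤ x := by positivity
  have hx1 : x ≤ 1 := (div_le_one ha0).2 hba
  have hbx : b = a * x := by rw [hx]; field_simp
  have e1 : a ^ n + (q - 1) * b ^ n = a ^ n * (1 + (q - 1) * x ^ n) := by
    rw [hbx, mul_pow]; ring
  have e2 : a ^ m + (q - 1) * (a ^ t * b ^ s) = a ^ m * (1 + (q - 1) * x ^ s) := by
    rw [hbx, mul_pow, ← hm, pow_add]; ring
  have hq1 : 0 < q - 1 := by linarith
  have p1 : 1 ≤ 1 + (q - 1) * x ^ n := by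
    have : 0 ≤ (q - 1) * x ^ n := by positivity
    linarith
  have p2 : 1 + (q - 1) * x ^ n ≤ 1 + (q - 1) * x ^ s := by
    have : x ^ n ≤ x ^ s := pow_le_pow_of_le_one hx0 hx1 (by omega)
    nlinarith
  rw [e1, e2, Real.logb_mul (by positivity) (by linarith), Real.logb_mul (by positivity)
    (by linarith), Real.logb_pow, Real.logb_pow]
  have l1 : 0 ≤ Real.logb q (1 + (q - 1) * x ^ n) := Real.logb_nonneg hq p1
  have l2 : Real.logb q (1 + (q - 1) * x ^ n) ≤ Real.logb q (1 + (q - 1) * x ^ s) :=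
    Real.logb_le_logb_of_le hq (by linarith) p2
  have hn' : (0 : ℝ) < n := by exact_mod_cast hn
  have hmn' : (m : ℝ) / n ≤ 1 := (div_le_one hn').2 (by exact_mod_cast hmn)
  have : (m : ℝ) * (1 / n * (n * Real.logb q a + Real.logb q (1 + (q - 1) * x ^ n))) =
      m * Real.logb q a + (m / n) * Real.logb q (1 + (q - 1) * x ^ n) := by
    field_simp
  rw [this]
  nlinarith

variable {K : Type} [Field K] [Fintype K] [DecidableEq K]

lemma zero_mem_parityCode {ι : Type*} [Fintype ι] [DecidableEq ι] (h : ι → K) :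
    0 ∈ parityCode h := by simp [parityCode]

lemma card_mul_eval_parityCode {ι : Type*} [Fintype ι] [DecidableEq ι] (h : ι → K) (z : ℝ) :
    (Fintype.card K : ℝ) * (wtEnum (parityCode h)).eval z =
    (1 + ((Fintype.card K : ℝ) - 1) * z) ^ Fintype.card ι +
      ((Fintype.card K : ℝ) - 1) *
        ((1 + ((Fintype.card K : ℝ) - 1) * z) ^ (Finset.univ.filter fun i => h i = 0).card *
        (1 - z) ^ (Finset.univ.filter fun i => h i ≠ 0).card) := by
  have := congrArg (Polynomial.eval z) (card_mul_wtEnum_parityCode h)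
  simpa using this

lemma card_mul_eval_one_parityCode {ι : Type*} [Fintype ι] [DecidableEq ι] (h : ι → K)
    (hs : 1 ≤ (Finset.univ.filter fun i => h i ≠ 0).card) :
    (Fintype.card K : ℝ) * (wtEnum (parityCode h)).eval 1 =
      (Fintype.card K : ℝ) ^ Fintype.card ι := by
  rw [card_mul_eval_parityCode, sub_self, zero_pow (by omega)]
  simp

lemma logb_eval_parityCode_ge {ι : Type*} [Fintype ι] [DecidableEq ι] (h : ι → K) {n : ℕ}
    (hs : 1 ≤ (Finset.univ.filter fun i => h i ≠ 0).card) (hn : Fintype.card ι ≤ n) {z : ℝ}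
    (hz : 0 ≤ z) (hz1 : z ≤ 1) (hn0 : 0 < n) :
    (Fintype.card ι : ℝ) * (-1 + (1 / n) * Real.logb (Fintype.card K)
      ((1 + ((Fintype.card K : ℝ) - 1) * z) ^ n + ((Fintype.card K : ℝ) - 1) * (1 - z) ^ n)) ≤
    Real.logb (Fintype.card K) ((wtEnum (parityCode h)).eval z) -
      Real.logb (Fintype.card K) ((wtEnum (parityCode h)).eval 1) := by
  have hq : (1 : ℝ) < Fintype.card K := by exact_mod_cast Fintype.one_lt_card
  have e1 := card_mul_eval_one_parityCode h hs
  have ez := card_mul_eval_parityCode h z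
  have p1 := one_le_eval_wtEnum (zero_mem_parityCode h) zero_le_one
  have pz := one_le_eval_wtEnum (zero_mem_parityCode h) hz
  set q : ℝ := (Fintype.card K : ℝ)
  have l1 := congrArg (Real.logb q) e1
  have lz := congrArg (Real.logb q) ez
  rw [Real.logb_mul (by positivity) (by positivity), Real.logb_pow,
    Real.logb_self_eq_one hq] at l1
  rw [Real.logb_mul (by positivity) (by positivity), Real.logb_self_eq_one hq] at lz
  have hcard : (Finset.univ.filter fun i => h i = 0).card +
      (Finset.univ.filter fun i => h i ≠ 0).card = Fintype.card ι :=
    Finset.card_filter_add_card_filter_not (s := Finset.univ) (fun i => h i = 0)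
  have key := block_log_le hq (a := 1 + (q - 1) * z) (b := 1 - z) (by nlinarith) (by linarith)
    (by nlinarith) hcard hn hn0
  linarith

lemma tiltMean_one_parityCode {ι : Type*} [Fintype ι] [DecidableEq ι] (h : ι → K)
    (hs : 2 ≤ (Finset.univ.filter fun i => h i ≠ 0).card) :
    tiltMean (wtEnum (parityCode h)) 1 =
      ((Fintype.card K : ℝ) - 1) / Fintype.card K * Fintype.card ι := by
  have hq : (1 : ℝ) < Fintype.card K := by exact_mod_cast Fintype.one_lt_card
  have e1 := card_mul_eval_one_parityCode h (by omega)
  obtain ⟨s, hs'⟩ : ∃ s, (Finset.univ.filter fun i => h i ≠ 0).card = s + 2 :=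
    ⟨_, (Nat.sub_add_cancel hs).symm⟩
  have hm : (Finset.univ.filter fun i => h i ≠ 0).card ≤ Fintype.card ι :=
    Finset.card_le_univ _
  obtain ⟨m, hm'⟩ : ∃ m, Fintype.card ι = m + 1 := ⟨Fintype.card ι - 1, by omega⟩
  have e2 := congrArg (fun p => (derivative p).eval 1) (card_mul_wtEnum_parityCode h)
  rw [hs', hm'] at e2
  rw [hm'] at e1 ⊢
  simp only [derivative_mul, derivative_natCast, derivative_add, derivative_one, derivative_sub,
    derivative_X, derivative_pow, eval_add, eval_mul, eval_sub, eval_one, eval_X, eval_pow,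
    eval_natCast, sub_self, zero_mul, zero_add, mul_one, map_natCast] at e2
  simp only [Nat.add_sub_cancel, add_sub_cancel, ne_eq, Nat.add_eq_zero_iff, OfNat.ofNat_ne_zero,
    and_false, not_false_eq_true, zero_pow, mul_zero, add_zero, zero_mul,
    show s + 2 - 1 = s + 1 by omega, one_ne_zero] at e2
  rw [tiltMean, eulerOp, eval_mul, eval_X, one_mul]
  have p1 := one_le_eval_wtEnum (zero_mem_parityCode h) zero_le_one
  set q : ℝ := (Fintype.card K : ℝ)
  rw [div_eq_iff (by positivity), div_mul_eq_mul_div, div_mul_eq_mul_div, eq_div_iff (by positivity)]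
  have hq0 : q ≠ 0 := by positivity
  apply mul_left_cancel₀ hq0
  rw [pow_succ] at e1
  linear_combination q * e2 - (q - 1) * ((m + 1 : ℕ) : ℝ) * e1

end Blocks

section BlockCodes

open Polynomial

lemma lambdaQ_le {q : ℕ} (hq : 1 < q) {ω : ℝ} (hω : 0 ≤ ω) (n : ℕ) {z : ℝ} (hz : 0 < z)
    (hz1 : z ≤ 1) :
    lambdaQ q ω n ≤ -ω * Real.logb q z - 1 / n +
      (1 / n) * Real.logb q ((1 + ((q:ℝ) - 1) * z) ^ n + ((q:ℝ) - 1) * (1 - z) ^ n) := by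
  have hq' : (1 : ℝ) < q := by exact_mod_cast hq
  refine ciInf_le (f := fun z : Set.Ioc (0:ℝ) 1 => -ω * Real.logb q (z : ℝ) - 1 / n +
      (1 / n) * Real.logb q ((1 + ((q:ℝ) - 1) * (z:ℝ)) ^ n + ((q:ℝ) - 1) * (1 - (z:ℝ)) ^ n))
      ?_ ⟨z, hz, hz1⟩
  refine ⟨-(1 / n), ?_⟩
  rintro _ ⟨⟨x, hx0, hx1⟩, rfl⟩
  have h1 : Real.logb q x ≤ 0 := Real.logb_nonpos hq' hx0.le hx1
  have h2 : 0 ≤ Real.logb q ((1 + ((q:ℝ) - 1) * x) ^ n + ((q:ℝ) - 1) * (1 - x) ^ n) := by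
    refine Real.logb_nonneg hq' ?_
    have : 1 ≤ (1 + ((q:ℝ) - 1) * x) ^ n := one_le_pow₀ (by nlinarith)
    have : 0 ≤ ((q:ℝ) - 1) * (1 - x) ^ n :=
      mul_nonneg (by linarith) (pow_nonneg (by linarith) _)
    linarith
  have h3 : 0 ≤ (1 / n : ℝ) *
      Real.logb q ((1 + ((q:ℝ) - 1) * x) ^ n + ((q:ℝ) - 1) * (1 - x) ^ n) := by positivity
  have h4 : 0 ≤ -ω * Real.logb q x := by nlinarith
  simp only
  linarith

lemma lambdaQ_zero_le {q : ℕ} (hq : 1 < q) (n : ℕ) : lambdaQ q 0 n ≤ 0 := by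
  have hq' : (1 : ℝ) < q := by exact_mod_cast hq
  have hc : ContinuousAt (fun z : ℝ => - (1 / n : ℝ) +
      (1 / n) * Real.logb q ((1 + ((q:ℝ) - 1) * z) ^ n + ((q:ℝ) - 1) * (1 - z) ^ n)) 0 := by
    refine continuousAt_const.add (continuousAt_const.mul ?_)
    unfold Real.logb
    refine ContinuousAt.div_const (ContinuousAt.log (by fun_prop) ?_) _
    simp; linarith
  have ht := hc.tendsto.mono_left (nhdsWithin_le_nhds (s := Set.Ioi 0))
  have h0 : - (1 / n : ℝ) +
      (1 / n) * Real.logb q ((1 + ((q:ℝ) - 1) * 0) ^ n + ((q:ℝ) - 1) * (1 - 0) ^ n) = 0 := by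
    simp [Real.logb_self_eq_one hq']
  rw [h0] at ht
  refine ge_of_tendsto ht ?_
  filter_upwards [Ioo_mem_nhdsGT (zero_lt_one' ℝ)] with z hz
  have := lambdaQ_le hq le_rfl n hz.1 hz.2.le
  linarith

/-- The sublinear loss in the comparison of a code with its constant-weight subcodes. -/
def weightLoss (q n : ℕ) (ω : ℝ) (N : ℕ) : ℝ :=
  Real.logb q (2 * ((N : ℝ) + 1)) +
    (Real.sqrt (2 * n * N) + 1) * Real.logb q ((q : ℝ) ^ n / ω)

variable {K : Type} [Field K] [Fintype K] [DecidableEq K]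
variable {ι κ : Type*} [Fintype ι] [Fintype κ] [DecidableEq κ] [DecidableEq ι]

lemma zero_mem_blockCode (l : ι → κ) (h : ι → K) : 0 ∈ blockCode l h := by
  simp [blockCode]

lemma sum_card_blocks {ι κ : Type*} [Fintype ι] [Fintype κ] [DecidableEq κ] (l : ι → κ) :
    ∑ b, Fintype.card {i // l i = b} = Fintype.card ι := by
  simpa using Fintype.sum_fiberwise l (fun _ => (1 : ℕ))

/-- The code has a large enough tilted weight enumerator for every tilt. -/
lemma logb_eval_blockCode_ge (l : ι → κ) (h : ι → K) {n : ℕ} (hn : 0 < n)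
    (hcard : ∀ b, Fintype.card {i // l i = b} ≤ n)
    (hsupp : ∀ b, 1 ≤ (Finset.univ.filter fun i : {i // l i = b} => h i ≠ 0).card)
    {z : ℝ} (hz : 0 ≤ z) (hz1 : z ≤ 1) :
    (Fintype.card ι : ℝ) * (-1 + (1 / n) * Real.logb (Fintype.card K)
      ((1 + ((Fintype.card K : ℝ) - 1) * z) ^ n + ((Fintype.card K : ℝ) - 1) * (1 - z) ^ n)) ≤
    Real.logb (Fintype.card K) ((wtEnum (blockCode l h)).eval z) -
      Real.logb (Fintype.card K) (blockCode l h).card := by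
  have hpos : ∀ y : ℝ, 0 ≤ y → ∀ b ∈ Finset.univ,
      (wtEnum (parityCode fun i : {i // l i = b} => h i)).eval y ≠ 0 := fun y hy b _ =>
    (lt_of_lt_of_le one_pos (one_le_eval_wtEnum (zero_mem_parityCode _) hy)).ne'
  rw [← eval_one_wtEnum, wtEnum_blockCode, eval_prod, eval_prod, Real.logb_prod _ _ (hpos z hz),
    Real.logb_prod _ _ (hpos 1 zero_le_one), ← Finset.sum_sub_distrib, ← sum_card_blocks l,
    Nat.cast_sum, Finset.sum_mul]
  exact Finset.sum_le_sum fun b _ => logb_eval_parityCode_ge _ (hsupp b) (hcard b) hz hz1 hn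

lemma tiltVar_blockCode_le (l : ι → κ) (h : ι → K) {n : ℕ}
    (hcard : ∀ b, Fintype.card {i // l i = b} ≤ n) {z : ℝ} (hz : 0 ≤ z) :
    tiltVar (wtEnum (blockCode l h)) z ≤ n * Fintype.card ι := by
  rw [wtEnum_blockCode, tiltVar_prod _ _ fun b =>
    (lt_of_lt_of_le one_pos (one_le_eval_wtEnum (zero_mem_parityCode _) hz)).ne',
    ← sum_card_blocks l, Nat.cast_sum, Finset.mul_sum]
  refine Finset.sum_le_sum fun b _ => (tiltVar_wtEnum_le (zero_mem_parityCode _) hz).trans ?_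
  rw [sq]
  gcongr
  exact hcard b

lemma tiltMean_blockCode_le (l : ι → κ) (h : ι → K) {n : ℕ}
    (hcard : ∀ b, Fintype.card {i // l i = b} ≤ n) {z : ℝ} (hz : 0 ≤ z) (hz1 : z ≤ 1) :
    tiltMean (wtEnum (blockCode l h)) z ≤ z * (Fintype.card K : ℝ) ^ n * Fintype.card ι := by
  rw [wtEnum_blockCode, tiltMean_prod _ _ fun b =>
    (lt_of_lt_of_le one_pos (one_le_eval_wtEnum (zero_mem_parityCode _) hz)).ne',
    ← sum_card_blocks l, Nat.cast_sum, Finset.mul_sum]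
  refine Finset.sum_le_sum fun b _ =>
    (tiltMean_wtEnum_le (zero_mem_parityCode _) hz hz1).trans ?_
  rw [mul_assoc, mul_comm (Fintype.card _ : ℝ)]
  gcongr
  have h1 : (parityCode fun i : {i // l i = b} => h i).card ≤
      Fintype.card K ^ Fintype.card {i // l i = b} :=
    (Finset.card_le_univ _).trans (by simp)
  exact_mod_cast h1.trans (Nat.pow_le_pow_right Fintype.card_pos (hcard b))

lemma tiltMean_one_blockCode_ge (l : ι → κ) (h : ι → K)
    (hsupp : ∀ b, 2 ≤ (Finset.univ.filter fun i : {i // l i = b} => h i ≠ 0).card ∨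
      Fintype.card {i // l i = b} = 1)
    (hone : ∀ b b', Fintype.card {i // l i = b} = 1 → Fintype.card {i // l i = b'} = 1 → b = b') :
    ((Fintype.card K : ℝ) - 1) / Fintype.card K * Fintype.card ι - 1 ≤
      tiltMean (wtEnum (blockCode l h)) 1 := by
  have hq : (1 : ℝ) < Fintype.card K := by exact_mod_cast Fintype.one_lt_card
  set c : ℝ := ((Fintype.card K : ℝ) - 1) / Fintype.card K with hc
  have hc1 : c ≤ 1 := by rw [hc, div_le_one (by linarith)]; linarith
  rw [wtEnum_blockCode, tiltMean_prod _ _ fun b =>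
    (lt_of_lt_of_le one_pos (one_le_eval_wtEnum (zero_mem_parityCode _) zero_le_one)).ne',
    ← sum_card_blocks l, Nat.cast_sum, Finset.mul_sum]
  have hle : ∀ b, c * (Fintype.card {i // l i = b} : ℝ) -
      (if Fintype.card {i // l i = b} = 1 then 1 else 0) ≤
      tiltMean (wtEnum (parityCode fun i : {i // l i = b} => h i)) 1 := by
    intro b
    by_cases h1 : Fintype.card {i // l i = b} = 1
    · have := tiltMean_wtEnum_nonneg (parityCode fun i : {i // l i = b} => h i) zero_le_one
      rw [if_pos h1, h1]
      push_cast
      linarith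
    · rw [if_neg h1, sub_zero, tiltMean_one_parityCode _ ((hsupp b).resolve_right h1)]
  have hsum := Finset.sum_le_sum fun b (_ : b ∈ Finset.univ) => hle b
  rw [Finset.sum_sub_distrib] at hsum
  have hfew : ∑ b, (if Fintype.card {i // l i = b} = 1 then (1 : ℝ) else 0) ≤ 1 := by
    rw [Finset.sum_boole]
    have : (Finset.univ.filter fun b => Fintype.card {i // l i = b} = 1).card ≤ 1 := by
      refine Finset.card_le_one.2 fun b hb b' hb' => hone b b' ?_ ?_
      · exact (Finset.mem_filter.1 hb).2
      · exact (Finset.mem_filter.1 hb').2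
    exact_mod_cast this
  linarith

/-- There is a tilt whose mean weight is within one of the target. -/
lemma exists_tilt (l : ι → κ) (h : ι → K) {n : ℕ}
    (hcard : ∀ b, Fintype.card {i // l i = b} ≤ n)
    (hsupp : ∀ b, 2 ≤ (Finset.univ.filter fun i : {i // l i = b} => h i ≠ 0).card ∨
      Fintype.card {i // l i = b} = 1)
    (hone : ∀ b b', Fintype.card {i // l i = b} = 1 → Fintype.card {i // l i = b'} = 1 → b = b')
    {ω : ℝ} (hω0 : 0 < ω) (hω1 : ω ≤ ((Fintype.card K : ℝ) - 1) / Fintype.card K) :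
    ∃ z : ℝ, ω / (Fintype.card K : ℝ) ^ n ≤ z ∧ z ≤ 1 ∧
      |tiltMean (wtEnum (blockCode l h)) z - ω * Fintype.card ι| ≤ 1 := by
  have hq : (1 : ℝ) < Fintype.card K := by exact_mod_cast Fintype.one_lt_card
  have hω2 : ω ≤ 1 := hω1.trans (by rw [div_le_one (by linarith)]; linarith)
  set z₀ := ω / (Fintype.card K : ℝ) ^ n with hz₀
  have hz₀pos : 0 < z₀ := by positivity
  have hz₀1 : z₀ ≤ 1 := by
    rw [hz₀, div_le_one (by positivity)]
    exact hω2.trans (one_le_pow₀ hq.le)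
  by_cases hcase : ω * Fintype.card ι ≤ tiltMean (wtEnum (blockCode l h)) 1
  · have hlow : tiltMean (wtEnum (blockCode l h)) z₀ ≤ ω * Fintype.card ι := by
      refine (tiltMean_blockCode_le l h hcard hz₀pos.le hz₀1).trans (le_of_eq ?_)
      rw [hz₀]; field_simp
    have hcont : ContinuousOn (tiltMean (wtEnum (blockCode l h))) (Set.Icc z₀ 1) := by
      unfold tiltMean
      refine ContinuousOn.div (by fun_prop) (by fun_prop) fun z hz => ?_
      exact (lt_of_lt_of_le one_pos (one_le_eval_wtEnum (zero_mem_blockCode l h)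
        (hz₀pos.le.trans hz.1))).ne'
    obtain ⟨z, hz, he⟩ := intermediate_value_Icc hz₀1 hcont ⟨hlow, hcase⟩
    exact ⟨z, hz.1, hz.2, by simp [he]⟩
  · refine ⟨1, hz₀1, le_rfl, ?_⟩
    have h1 := tiltMean_one_blockCode_ge l h hsupp hone
    have h2 : ω * Fintype.card ι ≤
        ((Fintype.card K : ℝ) - 1) / Fintype.card K * Fintype.card ι := by gcongr
    rw [abs_le]
    constructor <;> linarith

/-- A block code contains many words of some weight close to a prescribed one. -/
lemma exists_weight_blockCode (l : ι → κ) (h : ι → K) {n : ℕ} (hn : 0 < n)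
    (hcard : ∀ b, Fintype.card {i // l i = b} ≤ n)
    (hsupp1 : ∀ b, 1 ≤ (Finset.univ.filter fun i : {i // l i = b} => h i ≠ 0).card)
    (hsupp : ∀ b, 2 ≤ (Finset.univ.filter fun i : {i // l i = b} => h i ≠ 0).card ∨
      Fintype.card {i // l i = b} = 1)
    (hone : ∀ b b', Fintype.card {i // l i = b} = 1 → Fintype.card {i // l i = b'} = 1 → b = b')
    (hN : 0 < Fintype.card ι)
    {ω : ℝ} (hω0 : 0 ≤ ω) (hω1 : ω ≤ ((Fintype.card K : ℝ) - 1) / Fintype.card K) :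
    ∃ w : ℕ, |(w : ℝ) - ω * Fintype.card ι| ≤ Real.sqrt (2 * n * Fintype.card ι) + 1 ∧
      0 < ((blockCode l h).filter fun v => hammingNorm v = w).card ∧
      Real.logb (Fintype.card K) (blockCode l h).card -
        Real.logb (Fintype.card K) ((blockCode l h).filter fun v => hammingNorm v = w).card ≤
        Fintype.card ι * R0 (Fintype.card K) ω n +
          weightLoss (Fintype.card K) n ω (Fintype.card ι) := by
  have hqn : 1 < Fintype.card K := Fintype.one_lt_card
  have hq : (1 : ℝ) < Fintype.card K := by exact_mod_cast hqn
  have hN' : (0 : ℝ) < Fintype.card ι := by exact_mod_cast hN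
  have hn' : (0 : ℝ) < n := by exact_mod_cast hn
  have hlog2 : 0 ≤ Real.logb (Fintype.card K) (2 * ((Fintype.card ι : ℝ) + 1)) :=
    Real.logb_nonneg hq (by linarith)
  rcases hω0.eq_or_lt with rfl | hω
  · have hV0 : ((blockCode l h).filter fun v => hammingNorm v = 0) = {0} := by
      ext v
      simp only [Finset.mem_filter, hammingNorm_eq_zero, Finset.mem_singleton]
      exact ⟨fun hv => hv.2, fun hv => ⟨hv ▸ zero_mem_blockCode l h, hv⟩⟩
    refine ⟨0, by simp; positivity, by rw [hV0]; simp, ?_⟩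
    have key := logb_eval_blockCode_ge l h hn hcard hsupp1 (z := 0) le_rfl zero_le_one
    have he : (wtEnum (blockCode l h)).eval 0 = 1 := by
      rw [eval_wtEnum, Finset.sum_eq_single_of_mem 0 (zero_mem_blockCode l h)]
      · simp
      · intro v _ hv
        exact zero_pow (by simpa using hv)
    rw [he] at key
    simp only [mul_zero, add_zero, one_pow, sub_zero, mul_one, add_sub_cancel, Real.logb_one,
      Real.logb_self_eq_one hq] at key
    have hR : ((n : ℝ) - 1) / n ≤ R0 (Fintype.card K) 0 n := by
      have := lambdaQ_zero_le hqn n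
      rw [R0]; linarith
    have hR' := mul_le_mul_of_nonneg_left hR hN'.le
    have e : ((n : ℝ) - 1) / n = 1 - 1 / n := by field_simp
    rw [e] at hR'
    simp only [hV0, Finset.card_singleton, Nat.cast_one, Real.logb_one, weightLoss, div_zero,
      Real.logb_zero, mul_zero]
    nlinarith
  obtain ⟨z, hz0, hz1, hmean⟩ := exists_tilt l h hcard hsupp hone hω hω1
  have hz₀ : 0 < ω / (Fintype.card K : ℝ) ^ n := by positivity
  have hz : 0 < z := hz₀.trans_le hz0
  have hrpos : 0 < Real.sqrt (2 * n * Fintype.card ι) := by positivity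
  obtain ⟨w, hw, hP⟩ := exists_weight_near_tiltMean (zero_mem_blockCode l h) hz.le hrpos
    (by
      rw [Real.sq_sqrt (by positivity)]
      have := tiltVar_blockCode_le l h hcard hz.le
      linarith)
  have hwω : |(w : ℝ) - ω * Fintype.card ι| ≤ Real.sqrt (2 * n * Fintype.card ι) + 1 :=
    (abs_sub_le _ _ _).trans (add_le_add hw hmean)
  have hPpos := one_le_eval_wtEnum (zero_mem_blockCode l h) hz.le
  have hVw : 0 < ((blockCode l h).filter fun v => hammingNorm v = w).card := by
    rw [Nat.pos_iff_ne_zero]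
    intro h0
    rw [h0] at hP
    simp at hP
    linarith
  refine ⟨w, hwω, hVw, ?_⟩
  have hVw' : (0 : ℝ) < ((blockCode l h).filter fun v => hammingNorm v = w).card := by
    exact_mod_cast hVw
  have hlogP := Real.logb_le_logb_of_le hq (by linarith) hP
  rw [Real.logb_mul (x := 2 * ((Fintype.card ι : ℝ) + 1)) (by positivity) (by positivity),
    Real.logb_mul hVw'.ne' (by positivity), Real.logb_pow] at hlogP
  have key := logb_eval_blockCode_ge l h hn hcard hsupp1 hz.le hz1
  have hlam := mul_le_mul_of_nonneg_left (lambdaQ_le hqn hω.le n hz hz1) hN'.le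
  have hlz : Real.logb (Fintype.card K) z ≤ 0 := Real.logb_nonpos hq hz.le hz1
  have hlz0 : -Real.logb (Fintype.card K) z ≤
      Real.logb (Fintype.card K) ((Fintype.card K : ℝ) ^ n / ω) := by
    rw [← Real.logb_inv]
    refine Real.logb_le_logb_of_le hq (by positivity) ?_
    rw [← inv_div]
    exact inv_anti₀ hz₀ hz0
  have hdev : ((ω * Fintype.card ι - w) * -Real.logb (Fintype.card K) z) ≤
      (Real.sqrt (2 * n * Fintype.card ι) + 1) *
        Real.logb (Fintype.card K) ((Fintype.card K : ℝ) ^ n / ω) := by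
    have h1 := (abs_le.1 hwω).1
    calc _ ≤ (Real.sqrt (2 * n * Fintype.card ι) + 1) * -Real.logb (Fintype.card K) z :=
          mul_le_mul_of_nonneg_right (by linarith) (by linarith)
      _ ≤ _ := mul_le_mul_of_nonneg_left hlz0 (by positivity)
  have e : (Fintype.card ι : ℝ) * (((n : ℝ) - 1) / n) =
      Fintype.card ι - Fintype.card ι * (1 / n) := by field_simp
  rw [R0, weightLoss, mul_sub, e]
  linarith

end BlockCodes

section Reduction

variable {K : Type} [Field K] {N : ℕ}

/-- The labelling `l` groups the coordinates into blocks of size at most `n`, each of which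
supports a parity check of `C`. -/
def IsCheckLabelling (C : Set (Fin N → K)) (n : ℕ) (l : Fin N → Finset (Fin N)) : Prop :=
  ∀ j, (Finset.univ.filter fun i => l i = l j).card ≤ n ∧
    ∃ g : Fin N → K, (∃ i, l i = l j ∧ g i ≠ 0) ∧
      ∀ c ∈ C, ∑ i with l i = l j, g i * c i = 0

lemma isCheckLabelling_of_isLinRecLRC {C : Set (Fin N → K)} {n : ℕ}
    {Rg : Fin N → Finset (Fin N)} (hR : IsLinRecLRC C n Rg) (hd : IsAllDisjoint Rg) :
    IsCheckLabelling C n Rg := by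
  classical
  intro j
  have hblock : (Finset.univ.filter fun i => Rg i = Rg j) = Rg j := by
    ext i
    simp only [Finset.mem_filter, Finset.mem_univ, true_and]
    refine ⟨fun h => h ▸ (hR i).1, fun h => (hd i j).resolve_right fun hdis => ?_⟩
    exact Finset.disjoint_left.1 hdis (hR i).1 h
  obtain ⟨hj, hcard, a, ha, hrec⟩ := hR j
  rw [hblock]
  refine ⟨hcard, fun i => (if i = j then 1 else 0) - a i, ⟨j, rfl, ?_⟩, fun c hc => ?_⟩
  · simp [ha j (by simp)]
  · have h1 : ∑ i ∈ Rg j, a i * c i = ∑ i, a i * c i :=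
      Finset.sum_subset (Finset.subset_univ _) fun i _ hi => by
        rw [ha i (fun h => hi (Finset.mem_of_mem_erase h)), zero_mul]
    simp only [sub_mul, Finset.sum_sub_distrib, h1, ← hrec c hc, ite_mul, one_mul, zero_mul,
      Finset.sum_ite_eq', hj, if_true, sub_self]

/-- Merging singleton blocks in pairs leaves at most one singleton block. -/
lemma exists_isCheckLabelling_few_singletons {C : Set (Fin N → K)} {n : ℕ} (hn : 2 ≤ n)
    (hex : ∃ l, IsCheckLabelling C n l) :
    ∃ l, IsCheckLabelling C n l ∧ ∀ a b, (∀ i, l i = l a → i = a) → (∀ i, l i = l b → i = b) →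
      a = b := by
  classical
  obtain ⟨l, hl, hmin⟩ := Set.exists_min_image {l | IsCheckLabelling C n l}
    (fun l => (Finset.univ.filter fun a => ∀ i, l i = l a → i = a).card) (Set.toFinite _) hex
  refine ⟨l, hl, fun a b ha hb => by_contra fun hab => ?_⟩
  set l' := Function.update l b (l a) with hl'
  have hlb : l' b = l a := by simp [hl']
  have hlo : ∀ i, i ≠ b → l' i = l i := fun i hi => by simp [hl', hi]
  have hblock : (Finset.univ.filter fun i => l' i = l a) = {a, b} := by
    ext i
    simp only [Finset.mem_filter, Finset.mem_univ, true_and, Finset.mem_insert,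
      Finset.mem_singleton]
    by_cases hi : i = b
    · simp [hi, hlb]
    · rw [hlo i hi]
      exact ⟨fun h => Or.inl (ha i h), fun h => by rw [h.resolve_right hi]⟩
  have hother : ∀ j, j ≠ a → j ≠ b → ∀ i, l' i = l' j ↔ l i = l j := by
    intro j hja hjb i
    rw [hlo j hjb]
    by_cases hi : i = b
    · subst hi
      rw [hlb]
      exact ⟨fun h => absurd (ha j h.symm) hja, fun h => absurd (hb j h.symm) hjb⟩
    · rw [hlo i hi]
  have hcheck : IsCheckLabelling C n l' := by
    intro j
    by_cases hj : j = a ∨ j = b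
    · have hlj : l' j = l a := by
        rcases hj with rfl | rfl
        · exact hlo _ hab
        · exact hlb
      rw [hlj, hblock]
      refine ⟨Finset.card_le_two.trans hn, ?_⟩
      obtain ⟨-, g, ⟨i, hi, hgi⟩, hg⟩ := hl a
      obtain rfl := ha i hi
      refine ⟨fun k => if k = i then g i else 0, ⟨i, by rw [hlo i hab], by simpa using hgi⟩, ?_⟩
      intro c hc
      have := hg c hc
      rw [show (Finset.univ.filter fun k => l k = l i) = {i} by
        ext k
        simp only [Finset.mem_filter, Finset.mem_univ, true_and, Finset.mem_singleton]
        exact ⟨ha k, fun h => by rw [h]⟩, Finset.sum_singleton] at this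
      rw [Finset.sum_pair hab]
      simp [this, Ne.symm hab]
    · push Not at hj
      simp only [hother j hj.1 hj.2]
      exact hl j
  refine absurd (hmin l' hcheck) (not_le.2 (Finset.card_lt_card ?_))
  refine Finset.ssubset_iff_subset_ne.2 ⟨fun j hj => ?_, fun he => ?_⟩
  · simp only [Finset.mem_filter, Finset.mem_univ, true_and] at hj ⊢
    by_cases hja : j = a
    · exact hja ▸ ha
    by_cases hjb : j = b
    · exact hjb ▸ hb
    exact fun i hi => hj i ((hother j hja hjb i).2 hi)
  · have hmem : a ∈ Finset.univ.filter fun a => ∀ i, l' i = l' a → i = a := by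
      rw [he]; simpa using ha
    simp only [Finset.mem_filter, Finset.mem_univ, true_and] at hmem
    exact hab (hmem b (by rw [hlb, hlo a hab])).symm

/-- Every all-disjoint linearly recoverable code maps, without decreasing distances, into a
block code whose checks involve at least two coordinates, apart from at most one block. -/
lemma exists_blockCode [Fintype K] [DecidableEq K] {C : Set (Fin N → K)} {n : ℕ} (hn : 2 ≤ n)
    {Rg : Fin N → Finset (Fin N)} (hR : IsLinRecLRC C n Rg) (hd : IsAllDisjoint Rg) :
    ∃ (κ : Type) (_ : Fintype κ) (_ : DecidableEq κ) (l : Fin N → κ) (h : Fin N → K)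
      (f : (Fin N → K) → (Fin N → K)),
      (∀ b, Fintype.card {i // l i = b} ≤ n) ∧
      (∀ b, 1 ≤ (Finset.univ.filter fun i : {i // l i = b} => h i ≠ 0).card) ∧
      (∀ b, 2 ≤ (Finset.univ.filter fun i : {i // l i = b} => h i ≠ 0).card ∨
        Fintype.card {i // l i = b} = 1) ∧
      (∀ b b', Fintype.card {i // l i = b} = 1 → Fintype.card {i // l i = b'} = 1 → b = b') ∧
      (∀ c ∈ C, f c ∈ blockCode l h) ∧
      ∀ c ∈ C, ∀ c' ∈ C, hammingDist c c' ≤ hammingDist (f c) (f c') := by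
  classical
  obtain ⟨l, hl, hone⟩ := exists_isCheckLabelling_few_singletons hn
    ⟨Rg, isCheckLabelling_of_isLinRecLRC hR hd⟩
  let L : Fin N → Set.range l := Set.rangeFactorization l
  have hL : ∀ i j, L i = L j ↔ l i = l j := fun i j => Subtype.ext_iff
  have hsurj : ∀ b, ∃ j, L j = b := Set.rangeFactorization_surjective
  have hchecks : ∀ b, ∃ g : {i // L i = b} → K, (∃ i, g i ≠ 0) ∧
      ∀ c ∈ C, ∑ i, g i * c i = 0 := by
    intro b
    obtain ⟨j, rfl⟩ := hsurj b
    obtain ⟨-, g, ⟨i, hi, hgi⟩, hg⟩ := hl j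
    refine ⟨fun i => g i, ⟨⟨i, (hL i j).2 hi⟩, hgi⟩, fun c hc => ?_⟩
    rw [← hg c hc]
    exact (Finset.sum_subtype (Finset.univ.filter fun i => l i = l j)
      (fun i => by simp [hL]) fun i => g i * c i).symm
  choose g hg0 hgC using hchecks
  -- `S b` says that the check of block `b` involves a single coordinate
  let S : Set.range l → Prop := fun b => ∃! i, g b i ≠ 0
  let h : Fin N → K := fun i => if S (L i) then 1 else g (L i) ⟨i, rfl⟩
  let f : (Fin N → K) → (Fin N → K) := fun c i =>
    if S (L i) ∧ g (L i) ⟨i, rfl⟩ ≠ 0 then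
      -∑ k ∈ Finset.univ.erase (⟨i, rfl⟩ : {k // L k = L i}), c k else c i
  have hval : ∀ b (i : {i // L i = b}), h i = if S b then 1 else g b i := by
    rintro b ⟨i, rfl⟩; rfl
  have fval : ∀ c b (i : {i // L i = b}), f c i = if S b ∧ g b i ≠ 0 then
      -∑ k ∈ Finset.univ.erase i, c k else c i := by
    rintro c b ⟨i, rfl⟩; rfl
  have hzero : ∀ c ∈ C, ∀ b (i : {i // L i = b}), S b → g b i ≠ 0 → c i = 0 := by
    intro c hc b i hS hi
    have hsum := hgC b c hc
    rw [Finset.sum_eq_single i (fun k _ hk => by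
      rw [by_contra fun hgk => hk (hS.unique hgk hi), zero_mul]) (by simp)] at hsum
    exact (mul_eq_zero.1 hsum).resolve_left hi
  have hsupp1 : ∀ b, 1 ≤ (Finset.univ.filter fun i : {i // L i = b} => h i ≠ 0).card := by
    intro b
    obtain ⟨i, hi⟩ := hg0 b
    refine Finset.card_pos.2 ⟨i, ?_⟩
    simp only [Finset.mem_filter, Finset.mem_univ, true_and, hval]
    split_ifs
    · exact one_ne_zero
    · exact hi
  refine ⟨Set.range l, inferInstance, inferInstance, L, h, f, ?_, hsupp1, ?_, ?_, ?_, ?_⟩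
  · intro b
    obtain ⟨j, rfl⟩ := hsurj b
    rw [Fintype.card_subtype]
    simp only [hL]
    exact (hl j).1
  · intro b
    by_cases hS : S b
    · simp only [hval, hS, if_true, ne_eq, one_ne_zero, not_false_eq_true, Finset.filter_true,
        Finset.card_univ]
      obtain ⟨i, -⟩ := hg0 b
      have : 0 < Fintype.card {i // L i = b} := Fintype.card_pos_iff.2 ⟨i⟩
      omega
    · refine Or.inl ?_
      simp only [hval, hS, if_false]
      obtain ⟨i, hi⟩ := hg0 b
      by_contra hlt
      refine hS ⟨i, hi, fun k hk => ?_⟩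
      have hle : (Finset.univ.filter fun i => g b i ≠ 0).card ≤ 1 := by omega
      exact Finset.card_le_one.1 hle k (by simpa using hk) i (by simpa using hi)
  · intro b b' hb hb'
    obtain ⟨j, rfl⟩ := hsurj b
    obtain ⟨j', rfl⟩ := hsurj b'
    have single : ∀ j, Fintype.card {i // L i = L j} = 1 → ∀ i, l i = l j → i = j := by
      intro j hj i hi
      have := (Fintype.card_le_one_iff.1 hj.le) ⟨i, (hL i j).2 hi⟩ ⟨j, rfl⟩
      exact congrArg Subtype.val this
    rw [hone j j' (single j hb) (single j' hb')]
  · intro c hc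
    simp only [blockCode, Finset.mem_filter, Finset.mem_univ, true_and]
    intro b
    by_cases hS : S b
    · obtain ⟨i, hi, hu⟩ := id hS
      simp only [hval, fval, hS, if_true, true_and, one_mul]
      rw [← Finset.add_sum_erase _ _ (Finset.mem_univ i), if_pos hi, neg_add_eq_zero]
      refine Finset.sum_congr rfl fun k hk => ?_
      rw [if_neg fun hgk => Finset.ne_of_mem_erase hk (hu k hgk)]
    · simp only [hval, fval, hS, if_false, false_and]
      exact hgC b c hc
  · intro c hc c' hc'
    refine Finset.card_le_card fun i hi => ?_
    simp only [Finset.mem_filter, Finset.mem_univ, true_and] at hi ⊢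
    have hnot : ¬ (S (L i) ∧ g (L i) ⟨i, rfl⟩ ≠ 0) := fun hb => hi <| by
      rw [hzero c hc (L i) ⟨i, rfl⟩ hb.1 hb.2, hzero c' hc' (L i) ⟨i, rfl⟩ hb.1 hb.2]
    simp only [f, if_neg hnot]
    exact hi

end Reduction

section Asymptotics

variable {K : Type}

/-- Averaging over translates: some translate of a subset of an additively closed `V` meets a
subset `W` of `V` in at least its expected proportion. -/
lemma exists_translate {G : Type*} [AddCommGroup G] [DecidableEq G] {V W A : Finset G}
    (hV : V.Nonempty) (hWV : W ⊆ V) (hAV : A ⊆ V) (hsub : ∀ x ∈ V, ∀ y ∈ V, x - y ∈ V) :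
    ∃ v ∈ V, A.card * W.card ≤ V.card * (A.filter fun c => c - v ∈ W).card := by
  have hsum : ∑ v ∈ V, (A.filter fun c => c - v ∈ W).card = A.card * W.card := by
    simp only [Finset.card_filter]
    rw [Finset.sum_comm, ← smul_eq_mul, ← Finset.sum_const]
    refine Finset.sum_congr rfl fun c hc => ?_
    rw [← Finset.card_filter]
    refine Finset.card_nbij' (fun v => c - v) (fun u => c - u) ?_ ?_ ?_ ?_
    · intro v hv
      exact (Finset.mem_filter.1 hv).2
    · intro u hu
      exact Finset.mem_filter.2 ⟨hsub c (hAV hc) u (hWV hu), by simpa using hu⟩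
    · intro v _; simp
    · intro u _; simp
  by_contra hcon
  push Not at hcon
  have hlt := Finset.sum_lt_sum_of_nonempty hV hcon
  rw [← Finset.mul_sum, hsum, Finset.sum_const, smul_eq_mul] at hlt
  exact lt_irrefl _ hlt

lemma minDist_le_hammingDist [DecidableEq K] {ι : Type} [Fintype ι] {C : Set (ι → K)} {c c' : ι → K}
    (hc : c ∈ C) (hc' : c' ∈ C) (hne : c ≠ c') : minDist C ≤ hammingDist c c' :=
  Nat.sInf_le ⟨c, hc, c', hc', hne, rfl⟩

lemma minDist_le_card [DecidableEq K] {ι : Type} [Fintype ι] (C : Set (ι → K)) :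
    minDist C ≤ Fintype.card ι := by
  rcases Set.eq_empty_or_nonempty
    {d : ℕ | ∃ c ∈ C, ∃ c' ∈ C, c ≠ c' ∧ hammingDist c c' = d} with h | h
  · rw [minDist, h]; simp
  · obtain ⟨c, -, c', -, -, h⟩ := Nat.sInf_mem h
    rw [minDist, ← h]
    exact hammingDist_le_card_fintype

/-- A locally repairable code has a large constant-weight companion with no smaller distance. -/
lemma exists_constantWeight [Field K] [DecidableEq K] [Fintype K] {N : ℕ} (hN : 0 < N) {C : Set (Fin N → K)}
    (hC : C.Nonempty) {n : ℕ} (hn : 2 ≤ n)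
    (hLRC : ∃ Rg : Fin N → Finset (Fin N), IsLinRecLRC C n Rg ∧ IsAllDisjoint Rg)
    {ω : ℝ} (hω0 : 0 ≤ ω) (hω1 : ω ≤ ((Fintype.card K : ℝ) - 1) / Fintype.card K) :
    ∃ (w : ℕ) (D : Set (Fin N → K)), D.Nonempty ∧ (∀ c ∈ D, hammingNorm c = w) ∧
      |(w : ℝ) - ω * N| ≤ Real.sqrt (2 * n * N) + 1 ∧
      (2 ≤ D.ncard → minDist C ≤ minDist D) ∧
      Real.logb (Fintype.card K) C.ncard ≤ Real.logb (Fintype.card K) D.ncard +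
        N * R0 (Fintype.card K) ω n + weightLoss (Fintype.card K) n ω N := by
  classical
  have hq : (1 : ℝ) < Fintype.card K := by exact_mod_cast Fintype.one_lt_card (α := K)
  obtain ⟨Rg, hR, hd⟩ := hLRC
  obtain ⟨κ, _, _, l, h, f, hcard, hsupp1, hsupp, hone, hmem, hdist⟩ := exists_blockCode hn hR hd
  obtain ⟨w, hw, hW, hlog⟩ := exists_weight_blockCode l h (by omega) hcard hsupp1 hsupp hone
    (by simpa using hN) hω0 hω1
  rw [Fintype.card_fin] at hw hlog
  set V := blockCode l h with hVdef
  set W := V.filter fun v => hammingNorm v = w with hWdef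
  have hinj : Set.InjOn f C := by
    intro c hc c' hc' he
    have := hdist c hc c' hc'
    rw [he, hammingDist_self] at this
    exact hammingDist_eq_zero.1 (Nat.le_zero.1 this)
  set A := C.toFinite.toFinset.image f with hA
  have hAC : A.card = C.ncard := by
    rw [hA, Finset.card_image_of_injOn (by simpa using hinj), Set.ncard_eq_toFinset_card C]
  have hAV : A ⊆ V := by
    intro x hx
    obtain ⟨c, hc, rfl⟩ := Finset.mem_image.1 hx
    exact hmem c (by simpa using hc)
  obtain ⟨v, -, hv⟩ := exists_translate (V := V) (W := W) (A := A) ⟨0, zero_mem_blockCode l h⟩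
    (Finset.filter_subset _ _) hAV (by
      intro x hx y hy
      simp only [hVdef, blockCode, Finset.mem_filter, Finset.mem_univ, true_and] at hx hy ⊢
      intro b
      simp [mul_sub, hx b, hy b])
  set B := A.filter fun c => c - v ∈ W with hB
  have hCpos : 0 < C.ncard := (Set.ncard_pos).2 hC
  have hVpos : 0 < V.card := Finset.card_pos.2 ⟨0, zero_mem_blockCode l h⟩
  have hBpos : 0 < B.card := by
    rw [Nat.pos_iff_ne_zero]
    intro h0
    rw [h0, mul_zero, hAC] at hv
    have := Nat.mul_pos hCpos hW
    omega
  have hDcard : (B.image fun c => c - v).card = B.card :=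
    Finset.card_image_of_injective _ (sub_left_injective)
  refine ⟨w, ↑(B.image fun c => c - v), ?_, ?_, hw, ?_, ?_⟩
  · rw [Finset.coe_nonempty, ← Finset.card_pos, hDcard]
    exact hBpos
  · intro c hc
    obtain ⟨x, hx, rfl⟩ := Finset.mem_image.1 (Finset.mem_coe.1 hc)
    exact (Finset.mem_filter.1 (Finset.mem_filter.1 hx).2).2
  · intro h2
    obtain ⟨x, hx, y, hy, hxy⟩ := (Set.one_lt_ncard (Set.toFinite _)).1 h2
    refine le_csInf ⟨_, x, hx, y, hy, hxy, rfl⟩ ?_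
    rintro _ ⟨x, hx, y, hy, hxy, rfl⟩
    obtain ⟨a, ha, rfl⟩ := Finset.mem_image.1 (Finset.mem_coe.1 hx)
    obtain ⟨b, hb, rfl⟩ := Finset.mem_image.1 (Finset.mem_coe.1 hy)
    obtain ⟨c, hc, rfl⟩ := Finset.mem_image.1 (Finset.mem_filter.1 ha).1
    obtain ⟨c', hc', rfl⟩ := Finset.mem_image.1 (Finset.mem_filter.1 hb).1
    have hcC : c ∈ C := by simpa using hc
    have hcC' : c' ∈ C := by simpa using hc'
    have hne : c ≠ c' := fun he => hxy (by rw [he])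
    refine (minDist_le_hammingDist hcC hcC' hne).trans ((hdist c hcC c' hcC').trans ?_)
    simp [hammingDist]
  · rw [Set.ncard_coe_finset, hDcard]
    have hv' : (C.ncard : ℝ) * W.card ≤ V.card * B.card := by
      rw [← hAC]; exact_mod_cast hv
    have hC' : (0 : ℝ) < C.ncard := by exact_mod_cast hCpos
    have hW' : (0 : ℝ) < W.card := by exact_mod_cast hW
    have hV' : (0 : ℝ) < V.card := by exact_mod_cast hVpos
    have hB' : (0 : ℝ) < B.card := by exact_mod_cast hBpos
    have := Real.logb_le_logb_of_le hq (by positivity) hv'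
    rw [Real.logb_mul hC'.ne' hW'.ne', Real.logb_mul hV'.ne' hB'.ne'] at this
    linarith

lemma tendsto_sqrt_div (n : ℕ) :
    Tendsto (fun N : ℕ => (Real.sqrt (2 * n * N) + 1) / (N : ℝ)) atTop (nhds 0) := by
  have h1 : Tendsto (fun N : ℕ => (Real.sqrt (N : ℝ))⁻¹) atTop (nhds 0) :=
    (Real.tendsto_sqrt_atTop.comp tendsto_natCast_atTop_atTop).inv_tendsto_atTop
  have h2 : Tendsto (fun N : ℕ => ((N : ℝ))⁻¹) atTop (nhds 0) := tendsto_inv_atTop_nhds_zero_nat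
  have h3 := (h1.const_mul (Real.sqrt (2 * n))).add h2
  rw [mul_zero, add_zero] at h3
  refine h3.congr fun N => ?_
  rw [Real.sqrt_mul (show (0 : ℝ) ≤ 2 * n by positivity) (N : ℝ), add_div, mul_div_assoc,
    Real.sqrt_div_self', one_div, one_div]

lemma tendsto_weightLoss_div (q n : ℕ) (ω : ℝ) :
    Tendsto (fun N : ℕ => weightLoss q n ω N / (N : ℝ)) atTop (nhds 0) := by
  have h1 := (tendsto_sqrt_div n).mul_const (Real.logb q ((q : ℝ) ^ n / ω))
  have h2 : Tendsto (fun N : ℕ => Real.log (2 * ((N : ℝ) + 1)) / (N : ℝ)) atTop (nhds 0) := by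
    have h := Real.isLittleO_log_id_atTop.tendsto_div_nhds_zero
    have hc : Tendsto (fun N : ℕ => 2 * ((N : ℝ) + 1)) atTop atTop :=
      (tendsto_atTop_add_const_right _ _ tendsto_natCast_atTop_atTop).const_mul_atTop two_pos
    have h' := h.comp hc
    have hr : Tendsto (fun N : ℕ => 2 + 2 * ((N : ℝ))⁻¹) atTop (nhds (2 + 2 * 0)) :=
      tendsto_const_nhds.add (tendsto_inv_atTop_nhds_zero_nat.const_mul 2)
    have h3 := h'.mul hr
    rw [zero_mul] at h3
    refine h3.congr' ?_
    filter_upwards [eventually_gt_atTop 0] with N hN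
    have : (0 : ℝ) < N := by exact_mod_cast hN
    simp only [Function.comp, id]
    field_simp
  have h4 := (h2.div_const (Real.log q)).add h1
  rw [zero_div, zero_mul, add_zero] at h4
  refine h4.congr fun N => ?_
  rw [weightLoss, ← Real.log_div_log (x := 2 * ((N : ℝ) + 1))]
  ring

lemma rate_nonneg [Field K] [Fintype K] {N : ℕ} (C : Set (Fin N → K)) :
    0 ≤ Real.logb (Fintype.card K) (C.ncard : ℝ) / (N : ℝ) := by
  have hq : (1 : ℝ) < Fintype.card K := by exact_mod_cast Fintype.one_lt_card (α := K)
  refine div_nonneg ?_ (Nat.cast_nonneg _)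
  rcases Nat.eq_zero_or_pos C.ncard with h | h
  · simp [h]
  · exact Real.logb_nonneg hq (by exact_mod_cast h)

lemma rate_le_one [Field K] [Fintype K] {N : ℕ} (C : Set (Fin N → K)) :
    Real.logb (Fintype.card K) (C.ncard : ℝ) / (N : ℝ) ≤ 1 := by
  have hq : (1 : ℝ) < Fintype.card K := by exact_mod_cast Fintype.one_lt_card (α := K)
  refine div_le_one_of_le₀ ?_ (Nat.cast_nonneg _)
  rcases Nat.eq_zero_or_pos C.ncard with h | h
  · simp [h]
  · have hle : C.ncard ≤ Fintype.card K ^ N := by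
      rw [Set.ncard_eq_toFinset_card C]
      exact (Finset.card_le_univ _).trans (by simp)
    have hle' : (C.ncard : ℝ) ≤ (Fintype.card K : ℝ) ^ N := by exact_mod_cast hle
    have := Real.logb_le_logb_of_le hq (by exact_mod_cast h) hle'
    rwa [Real.logb_pow, Real.logb_self_eq_one hq, mul_one] at this

lemma relDist_le_one [DecidableEq K] {N : ℕ} (C : Set (Fin N → K)) :
    (minDist C : ℝ) / (N : ℝ) ≤ 1 := by
  refine div_le_one_of_le₀ ?_ (Nat.cast_nonneg _)
  have := minDist_le_card C
  rw [Fintype.card_fin] at this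
  exact_mod_cast this

lemma isBoundedUnder_le_of_forall {u : ℕ → ℝ} {a : ℝ} (h : ∀ i, u i ≤ a) :
    IsBoundedUnder (· ≤ ·) atTop u := isBoundedUnder_of ⟨a, h⟩

lemma isBoundedUnder_ge_of_forall {u : ℕ → ℝ} {a : ℝ} (h : ∀ i, a ≤ u i) :
    IsBoundedUnder (· ≥ ·) atTop u := isBoundedUnder_of ⟨a, h⟩

lemma RoptCW_nonneg [Field K] [DecidableEq K] [Fintype K] (δ ω : ℝ) : 0 ≤ RoptCW K (Fintype.card K) δ ω := by
  refine Real.sSup_nonneg ?_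
  rintro _ ⟨N, C, w, -, -, -, -, -, rfl⟩
  exact le_limsup_of_le (isBoundedUnder_le_of_forall fun i => rate_le_one (C i))
    fun b hb => by
      obtain ⟨i, hi⟩ := hb.exists
      exact (rate_nonneg (C i)).trans hi

lemma limsup_le_RoptCW [Field K] [DecidableEq K] [Fintype K] {δ ω : ℝ} {N : ℕ → ℕ}
    {C : ∀ i : ℕ, Set (Fin (N i) → K)}
    {w : ℕ → ℕ} (hN : StrictMono N) (hC : ∀ i, (C i).Nonempty)
    (hw : ∀ i, ∀ c ∈ C i, hammingNorm c = w i)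
    (hlim : Tendsto (fun i => (w i : ℝ) / (N i : ℝ)) atTop (nhds ω))
    (hd : δ ≤ liminf (fun i => (minDist (C i) : ℝ) / (N i : ℝ)) atTop) :
    limsup (fun i => Real.logb (Fintype.card K) ((C i).ncard : ℝ) / (N i : ℝ)) atTop ≤
      RoptCW K (Fintype.card K) δ ω := by
  refine le_csSup ⟨1, ?_⟩ ⟨N, C, w, hN, hC, hw, hlim, hd, rfl⟩
  rintro _ ⟨N, C, w, -, -, -, -, -, rfl⟩
  exact limsup_le_of_le (isBoundedUnder_ge_of_forall fun i => rate_nonneg (C i)).isCoboundedUnder_le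
    (Eventually.of_forall fun i => rate_le_one (C i))

end Asymptotics

/-- Theorem 2: the rate of every all-disjoint linearly recoverable `(δ,n)`-LRC sequence
over `F` is bounded from above by
`R_2(δ,n) = min_{ω ∈ [δ/2,(q-1)/q]} { R_0(ω,n) + R_opt(δ,ω) }`. -/
theorem bound2
    (K : Type) [Field K] [Fintype K] [DecidableEq K]
    (q : ℕ) (hq : Fintype.card K = q)
    (n : ℕ) (hn : 2 ≤ n)
    (δ : ℝ) (hδ : δ ∈ Set.Ico (0:ℝ) (((q:ℝ) - 1) / q))
    -- the given all-disjoint linearly recoverable `(δ,n)`-LRC sequence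
    (N : ℕ → ℕ) (C : ∀ i : ℕ, Set (Fin (N i) → K))
    (hmono : StrictMono N) (hne : ∀ i, (C i).Nonempty)
    (hLRC : ∀ i, ∃ Rg : Fin (N i) → Finset (Fin (N i)),
      IsLinRecLRC (C i) n Rg ∧ IsAllDisjoint Rg)
    (hdist : δ ≤ liminf (fun i => (minDist (C i) : ℝ) / (N i : ℝ)) atTop)
    -- an arbitrary admissible `ω`
    (ω : ℝ) (hω : ω ∈ Set.Icc (δ / 2) (((q:ℝ) - 1) / q)) :
    limsup (fun i => Real.logb q ((C i).ncard : ℝ) / (N i : ℝ)) atTop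
      ≤ R0 q ω n + RoptCW K q δ ω := by
  subst hq
  have hqn : 1 < Fintype.card K := Fintype.one_lt_card
  have hq : (1 : ℝ) < Fintype.card K := by exact_mod_cast hqn
  have hω0 : 0 ≤ ω := le_trans (div_nonneg hδ.1 two_pos.le) hω.1
  refine le_of_forall_pos_le_add fun ε hε => ?_
  by_contra hcon
  rw [not_le] at hcon
  set ρ := RoptCW K (Fintype.card K) δ ω with hρ
  have hρ0 : 0 ≤ ρ := RoptCW_nonneg δ ω
  have hfreq : ∃ᶠ i in atTop, R0 (Fintype.card K) ω n + ρ + ε <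
      Real.logb (Fintype.card K) ((C i).ncard : ℝ) / (N i : ℝ) :=
    frequently_lt_of_lt_limsup
      (isBoundedUnder_ge_of_forall fun i => rate_nonneg (C i)).isCoboundedUnder_le hcon
  have hNtop : Tendsto N atTop atTop := hmono.tendsto_atTop
  have hloss : ∀ᶠ i in atTop, weightLoss (Fintype.card K) n ω (N i) / (N i : ℝ) < ε / 2 :=
    ((tendsto_weightLoss_div _ n ω).comp hNtop).eventually (gt_mem_nhds (half_pos hε))
  have hNpos : ∀ᶠ i in atTop, 0 < N i := hNtop.eventually (eventually_gt_atTop 0)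
  obtain ⟨φ, hφ, hgood⟩ := extraction_of_frequently_atTop (hfreq.and_eventually (hloss.and hNpos))
  choose w D hDne hDw hwω hDdist hDlog using fun k =>
    exists_constantWeight (hgood k).2.2 (hne (φ k)) hn (hLRC (φ k)) hω0 hω.2
  have hrate : ∀ k, ρ + ε / 2 <
      Real.logb (Fintype.card K) ((D k).ncard : ℝ) / (N (φ k) : ℝ) := by
    intro k
    obtain ⟨h1, h2, h3⟩ := hgood k
    have hpos : (0 : ℝ) < N (φ k) := by exact_mod_cast h3
    have h4 := div_le_div_of_nonneg_right (hDlog k) hpos.le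
    rw [add_div, add_div, mul_div_cancel_left₀ _ hpos.ne'] at h4
    linarith
  have hcardD : ∀ k, 2 ≤ (D k).ncard := by
    intro k
    by_contra hlt
    have h1 : (D k).ncard = 1 := by
      have := (Set.ncard_pos).2 (hDne k)
      omega
    have := hrate k
    rw [h1, Nat.cast_one, Real.logb_one, zero_div] at this
    linarith
  have hNφ : StrictMono fun k => N (φ k) := hmono.comp hφ
  have hlim : Tendsto (fun k => (w k : ℝ) / (N (φ k) : ℝ)) atTop (nhds ω) := by
    rw [tendsto_iff_norm_sub_tendsto_zero]
    refine squeeze_zero (fun _ => norm_nonneg _) (fun k => ?_)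
      ((tendsto_sqrt_div n).comp hNφ.tendsto_atTop)
    have hpos : (0 : ℝ) < N (φ k) := by exact_mod_cast (hgood k).2.2
    simp only [Function.comp, Real.norm_eq_abs]
    rw [le_div_iff₀ hpos, ← abs_of_pos hpos, ← abs_mul, abs_of_pos hpos, sub_mul,
      div_mul_cancel₀ _ hpos.ne']
    exact hwω k
  have hdist' : δ ≤ liminf (fun k => (minDist (D k) : ℝ) / (N (φ k) : ℝ)) atTop := by
    refine hdist.trans ?_
    have hsub : liminf (fun i => (minDist (C i) : ℝ) / (N i : ℝ)) atTop ≤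
        liminf ((fun i => (minDist (C i) : ℝ) / (N i : ℝ)) ∘ φ) atTop := by
      rw [liminf_comp]
      refine liminf_le_liminf_of_le hφ.tendsto_atTop ?_ ?_
      · exact isBoundedUnder_ge_of_forall (a := 0) fun i => by positivity
      · rw [Filter.IsCoboundedUnder, Filter.map_map]
        exact (isBoundedUnder_le_of_forall (a := 1) fun k =>
          relDist_le_one (C (φ k))).isCoboundedUnder_ge
    refine hsub.trans (liminf_le_liminf (Eventually.of_forall fun k => ?_) ?_ ?_)
    · simp only [Function.comp]
      gcongr
      exact hDdist k (hcardD k)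
    · exact isBoundedUnder_ge_of_forall (a := 0) fun k => by
        simp only [Function.comp]; positivity
    · exact (isBoundedUnder_le_of_forall (a := 1) fun k =>
        relDist_le_one (D k)).isCoboundedUnder_ge
  have hle := limsup_le_RoptCW hNφ hDne hDw hlim hdist'
  have hge : ρ + ε / 2 ≤ limsup (fun k =>
      Real.logb (Fintype.card K) ((D k).ncard : ℝ) / (N (φ k) : ℝ)) atTop :=
    le_limsup_of_frequently_le (Frequently.of_forall fun k => (hrate k).le)
      (isBoundedUnder_le_of_forall fun k => rate_le_one (D k))
  linarith
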